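/- arXiv:2601.00541 — 2 statements merged into one kernel-verified Lean document; each statement's English description precedes it below -/
import Mathlib

section
/- Let (Ω, 𝔽, P) be a probability space, let W : Ω → ℝ be integrable (E|W| < ∞), and let X : Ω → ℝ^p be a random vector (p ≥ 1). Then E[W | X] = 0 P-almost surely if and only if for every α in the unit sphere S^{p-1} = {α ∈ ℝ^p : ‖α‖₂ = 1} one has E[W | ⟨α, X⟩] = 0 P-almost surely. (This is the first equivalence of Proposition 1(i).) -/
open MeasureTheory
open scoped RealInnerProductSpace

lemma setIntegral_eq_withDensity_sub {Ω : Type*} [MeasurableSpace Ω] (μ : Measure Ω)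
    (W : Ω → ℝ) (hW : Integrable W μ) {s : Set Ω} (hs : MeasurableSet s) :
    ∫ ω in s, W ω ∂μ =
      (μ.withDensity (fun ω => ENNReal.ofReal (W ω)) s).toReal -
      (μ.withDensity (fun ω => ENNReal.ofReal (-W ω)) s).toReal := by
  rw [integral_eq_lintegral_pos_part_sub_lintegral_neg_part hW.integrableOn,
    withDensity_apply _ hs, withDensity_apply _ hs]

lemma condExp_comap_eq_zero_iff_map_eq {Ω E : Type*} [mΩ : MeasurableSpace Ω]
    [mE : MeasurableSpace E] (μ : Measure Ω) [IsProbabilityMeasure μ]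
    (W : Ω → ℝ) (hW : Integrable W μ) (f : Ω → E) (hf : Measurable f) :
    μ[W|MeasurableSpace.comap f mE] =ᵐ[μ] 0 ↔
      (μ.withDensity (fun ω => ENNReal.ofReal (W ω))).map f =
      (μ.withDensity (fun ω => ENNReal.ofReal (-W ω))).map f := by
  have hm : MeasurableSpace.comap f mE ≤ mΩ := hf.comap_le
  have := isFiniteMeasure_withDensity_ofReal hW.2
  have := isFiniteMeasure_withDensity_ofReal hW.neg.2
  simp only [Pi.neg_apply] at this
  constructor
  · intro h
    ext B hB
    rw [Measure.map_apply hf hB, Measure.map_apply hf hB]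
    have h1 := setIntegral_condExp (μ := μ) hm hW (s := f ⁻¹' B) ⟨B, hB, rfl⟩
    rw [setIntegral_eq_withDensity_sub μ W hW (hf hB),
      integral_congr_ae (ae_restrict_of_ae h)] at h1
    simp only [Pi.zero_apply, integral_zero] at h1
    exact (ENNReal.toReal_eq_toReal_iff' (measure_ne_top _ _) (measure_ne_top _ _)).1
      (by linarith)
  · intro h
    symm
    refine ae_eq_condExp_of_forall_setIntegral_eq hm hW (fun s _ _ => integrableOn_zero) ?_
      stronglyMeasurable_zero.aestronglyMeasurable
    rintro s ⟨B, hB, rfl⟩ -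
    rw [setIntegral_eq_withDensity_sub μ W hW (hf hB), ← Measure.map_apply hf hB,
      ← Measure.map_apply hf hB, h]
    simp

lemma charFun_smul_eq_map_inner {p : ℕ} (ν : Measure (EuclideanSpace ℝ (Fin p)))
    (α : EuclideanSpace ℝ (Fin p)) (r : ℝ) :
    charFun ν (r • α) = charFun (ν.map (fun x => ⟪α, x⟫)) r := by
  rw [charFun_apply, charFun_apply, integral_map (by fun_prop) (by fun_prop)]
  congr 1
  ext x
  simp [inner_smul_right, real_inner_comm]

/-- Proposition 1(i), first equivalence: for an integrable `W` and a random vector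
`X : Ω → ℝ^p`, the conditional expectation `E[W | X]` vanishes almost surely iff for every
projection `α` on the unit sphere `S^{p-1}` the conditional expectation `E[W | ⟨α, X⟩]`
vanishes almost surely. -/
theorem condexp_given_X_eq_zero_iff_forall_sphere_condexp_proj_eq_zero
    {Ω : Type*} [MeasurableSpace Ω] (μ : Measure Ω) [IsProbabilityMeasure μ]
    {p : ℕ} (hp : 1 ≤ p)
    (W : Ω → ℝ) (hW : Integrable W μ)
    (X : Ω → EuclideanSpace ℝ (Fin p)) (hX : Measurable X) :
    μ[W|MeasurableSpace.comap X inferInstance] =ᵐ[μ] 0 ↔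
      ∀ α ∈ Metric.sphere (0 : EuclideanSpace ℝ (Fin p)) 1,
        μ[W|MeasurableSpace.comap (fun ω => ⟪α, X ω⟫) inferInstance] =ᵐ[μ] 0 := by
  have := isFiniteMeasure_withDensity_ofReal hW.2
  have := isFiniteMeasure_withDensity_ofReal hW.neg.2
  simp only [Pi.neg_apply] at this
  have hi : ∀ α : EuclideanSpace ℝ (Fin p), Measurable (fun x => ⟪α, x⟫) :=
    fun α => by fun_prop
  have key : ∀ (ν : Measure Ω) (α : EuclideanSpace ℝ (Fin p)),
      ν.map (fun ω => ⟪α, X ω⟫) = (ν.map X).map (fun x => ⟪α, x⟫) := fun ν α => by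
    rw [Measure.map_map (hi α) hX]; rfl
  rw [condExp_comap_eq_zero_iff_map_eq μ W hW X hX]
  constructor
  · intro h α _
    rw [condExp_comap_eq_zero_iff_map_eq μ W hW (fun ω => ⟪α, X ω⟫) ((hi α).comp hX), key, key, h]
  · intro h
    apply Measure.ext_of_charFun
    ext t
    obtain ⟨α, r, hα, rfl⟩ : ∃ (α : EuclideanSpace ℝ (Fin p)) (r : ℝ), ‖α‖ = 1 ∧ r • α = t := by
      by_cases ht : t = 0
      · exact ⟨EuclideanSpace.single ⟨0, hp⟩ 1, 0, by simp, by simp [ht]⟩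
      · have : ‖t‖ ≠ 0 := norm_ne_zero_iff.2 ht
        exact ⟨‖t‖⁻¹ • t, ‖t‖, by simp [norm_smul, this], by simp [smul_smul, this]⟩
    have h1 := h α (by simpa using hα)
    rw [condExp_comap_eq_zero_iff_map_eq μ W hW (fun ω => ⟪α, X ω⟫) ((hi α).comp hX), key, key] at h1
    rw [charFun_smul_eq_map_inner, charFun_smul_eq_map_inner, h1]
end

section
/- Let (Ω, 𝔽, P) be a probability space, let W : Ω → ℝ be integrable (E|W| < ∞), and let X : Ω → ℝ^p be a random vector. Then E[W | X] = 0 P-almost surely if and only if E[W · exp(i⟨s, X⟩)] = 0 for every s ∈ ℝ^p, where i is the imaginary unit. -/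
open MeasureTheory
open scoped RealInnerProductSpace

/-- Pushforward under `X` of the measure with density the positive part of `W`. -/
noncomputable def bierensPos {Ω E : Type*} [MeasurableSpace Ω] [MeasurableSpace E]
    (μ : Measure Ω) (W : Ω → ℝ) (X : Ω → E) : Measure E :=
  (μ.withDensity (fun ω => ENNReal.ofReal (W ω))).map X

lemma bierens_finite {Ω E : Type*} [MeasurableSpace Ω] [MeasurableSpace E]
    (μ : Measure Ω) (W : Ω → ℝ) (hW : Integrable W μ) (X : Ω → E) :
    IsFiniteMeasure (bierensPos μ W X) := by
  have : IsFiniteMeasure (μ.withDensity (fun ω => ENNReal.ofReal (W ω))) :=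
    isFiniteMeasure_withDensity_ofReal hW.2
  unfold bierensPos
  infer_instance

lemma bierens_apply {Ω E : Type*} [MeasurableSpace Ω] [MeasurableSpace E]
    (μ : Measure Ω) (W : Ω → ℝ) (X : Ω → E) (hX : Measurable X) {B : Set E}
    (hB : MeasurableSet B) :
    bierensPos μ W X B = ∫⁻ ω in X ⁻¹' B, ENNReal.ofReal (W ω) ∂μ := by
  rw [bierensPos, Measure.map_apply hX hB, withDensity_apply _ (hX hB)]

lemma bierens_setIntegral {Ω E : Type*} [MeasurableSpace Ω] [MeasurableSpace E]
    (μ : Measure Ω) (W : Ω → ℝ) (hW : Integrable W μ) (X : Ω → E) (hX : Measurable X) {B : Set E}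
    (hB : MeasurableSet B) :
    ∫ ω in X ⁻¹' B, W ω ∂μ =
      (bierensPos μ W X B).toReal - (bierensPos μ (fun ω => - W ω) X B).toReal := by
  rw [bierens_apply μ W X hX hB, bierens_apply μ _ X hX hB,
    integral_eq_lintegral_pos_part_sub_lintegral_neg_part hW.integrableOn]

lemma bierens_integral_one {Ω E : Type*} [MeasurableSpace Ω] [MeasurableSpace E]
    (μ : Measure Ω) (W : Ω → ℝ) (hW : Integrable W μ) (X : Ω → E) (hX : Measurable X)
    (g : E → ℂ) (hg : Measurable g) :
    ∫ x, g x ∂(bierensPos μ W X) = ∫ ω, ((max (W ω) 0 : ℝ) : ℂ) * g (X ω) ∂μ := by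
  rw [bierensPos, integral_map hX.aemeasurable hg.aestronglyMeasurable,
    integral_withDensity_eq_integral_toReal_smul₀ hW.1.aemeasurable.ennreal_ofReal (by simp)]
  simp [ENNReal.toReal_ofReal']

lemma bierens_integral {Ω E : Type*} [MeasurableSpace Ω] [MeasurableSpace E]
    (μ : Measure Ω) (W : Ω → ℝ) (hW : Integrable W μ) (X : Ω → E) (hX : Measurable X)
    (g : E → ℂ) (hg : Measurable g) (hg1 : ∀ x, ‖g x‖ ≤ 1) :
    ∫ ω, (W ω : ℂ) * g (X ω) ∂μ =
      ∫ x, g x ∂(bierensPos μ W X) - ∫ x, g x ∂(bierensPos μ (fun ω => - W ω) X) := by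
  have key : ∀ V : Ω → ℝ, Integrable V μ →
      Integrable (fun ω => ((max (V ω) 0 : ℝ) : ℂ) * g (X ω)) μ := fun V hV =>
    (hV.pos_part.ofReal (𝕜 := ℂ)).mul_bdd (c := 1) (hg.comp hX).aestronglyMeasurable
      (Filter.Eventually.of_forall fun ω => hg1 _)
  rw [bierens_integral_one μ W hW X hX g hg, bierens_integral_one μ (fun ω => - W ω) hW.neg X hX g hg,
    ← integral_sub (key W hW) (key (fun ω => - W ω) hW.neg)]
  congr 1
  ext ω
  rw [← sub_mul, ← Complex.ofReal_sub]
  congr 2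
  rcases le_total (W ω) 0 with h | h
  · rw [max_eq_right h, max_eq_left (by linarith)]; ring
  · rw [max_eq_left h, max_eq_right (by linarith)]; ring

lemma bierens_condExp {Ω E : Type*} [MeasurableSpace Ω] [mE : MeasurableSpace E]
    (μ : Measure Ω) [IsProbabilityMeasure μ]
    (W : Ω → ℝ) (hW : Integrable W μ) (X : Ω → E) (hX : Measurable X) :
    μ[W|MeasurableSpace.comap X mE] =ᵐ[μ] 0 ↔
      bierensPos μ W X = bierensPos μ (fun ω => - W ω) X := by
  have f1 := bierens_finite μ W hW X
  have f2 := bierens_finite μ (fun ω => - W ω) hW.neg X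
  constructor
  · intro h
    ext B hB
    have h1 := bierens_setIntegral μ W hW X hX hB
    rw [← setIntegral_condExp hX.comap_le hW ⟨B, hB, rfl⟩,
      integral_congr_ae (ae_restrict_of_ae h)] at h1
    simp only [Pi.zero_apply, integral_zero] at h1
    exact (ENNReal.toReal_eq_toReal_iff' (measure_ne_top _ _) (measure_ne_top _ _)).1
      (sub_eq_zero.1 h1.symm)
  · intro h
    symm
    refine ae_eq_condExp_of_forall_setIntegral_eq hX.comap_le hW ?_ ?_ ?_
    · intro s _ _
      exact integrableOn_zero
    · rintro s ⟨B, hB, rfl⟩ _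
      rw [bierens_setIntegral μ W hW X hX hB, ← h]
      simp
    · exact aestronglyMeasurable_zero

/-- Bierens' characteristic-function lemma: for an integrable `W` and a random vector
`X : Ω → ℝ^p`, the conditional expectation `E[W | X]` vanishes almost surely iff
`E[W · exp(i⟨s, X⟩)] = 0` for every `s ∈ ℝ^p`. -/
theorem condexp_given_X_eq_zero_iff_forall_charfun_integral_eq_zero
    {Ω : Type*} [MeasurableSpace Ω] (μ : Measure Ω) [IsProbabilityMeasure μ]
    {p : ℕ}
    (W : Ω → ℝ) (hW : Integrable W μ)
    (X : Ω → EuclideanSpace ℝ (Fin p)) (hX : Measurable X) :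
    μ[W|MeasurableSpace.comap X inferInstance] =ᵐ[μ] 0 ↔
      ∀ s : EuclideanSpace ℝ (Fin p),
        ∫ ω, (W ω : ℂ) * Complex.exp (Complex.I * (⟪s, X ω⟫ : ℝ)) ∂μ = 0 := by
  have f1 := bierens_finite μ W hW X
  have f2 := bierens_finite μ (fun ω => - W ω) hW.neg X
  have key : ∀ s : EuclideanSpace ℝ (Fin p),
      ∫ ω, (W ω : ℂ) * Complex.exp (Complex.I * (⟪s, X ω⟫ : ℝ)) ∂μ =
      charFun (bierensPos μ W X) s - charFun (bierensPos μ (fun ω => - W ω) X) s := by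
    intro s
    rw [charFun_apply, charFun_apply, ← bierens_integral μ W hW X hX
      (fun x => Complex.exp ((⟪x, s⟫ : ℝ) * Complex.I))
      (Continuous.measurable (by fun_prop))
      (fun x => (Complex.norm_exp_ofReal_mul_I _).le)]
    simp only [mul_comm Complex.I, real_inner_comm]
  refine (bierens_condExp μ W hW X hX).trans ⟨fun h s => ?_, fun h => ?_⟩
  · rw [key, ← h, sub_self]
  · refine Measure.ext_of_charFun (funext fun s => ?_)
    rw [← sub_eq_zero, ← key, h]
end
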